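/- Let R = ⟨v_0, …, v_k⟩ be a partial route, let R⁻¹ = ⟨v_k, …, v_0⟩ be its reversal considered in the reverse network D⁻¹, and let t, s ∈ [0, T] with t ≥ a(v_0) and s ≤ b(v_k). Then R is feasible for t in D with δ_D(R, t) ≤ s if and only if R⁻¹ is feasible for T − s in D⁻¹ with δ_{D⁻¹}(R⁻¹, T − s) ≤ T − t. -/

import Mathlib

noncomputable section

attribute [local instance] Classical.propDecidable

/-- `delta τ a r t i`: earliest arrival time at the `i`-th vertex of the partial route
`⟨r 0, …, r k⟩` when the vehicle departs from `r 0` at time `t`, taking waiting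
times (lower time-window bounds `a`) into account. -/
def delta (τ : ℕ → ℕ → ℝ) (a : ℕ → ℝ) (r : ℕ → ℕ) (t : ℝ) : ℕ → ℝ
  | 0 => max t (a (r 0))
  | i + 1 => max (delta τ a r t i + τ (r i) (r (i + 1))) (a (r (i + 1)))

/-- The partial route `⟨r 0, …, r k⟩` is feasible for departure time `t`:
the departure is not before `a (r 0)` and every vertex is reached before the
end `b` of its time window. -/
def Feasible (τ : ℕ → ℕ → ℝ) (a b : ℕ → ℝ) (r : ℕ → ℕ) (k : ℕ) (t : ℝ) : Prop :=
  a (r 0) ≤ t ∧ ∀ i ≤ k, delta τ a r t i ≤ b (r i)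

/-- `IsSchedule τ a b r k t s x`: the times `x 0, …, x k` respect the time windows and travel
times along `⟨r 0, …, r k⟩`, starting no earlier than `t` and ending no later than `s`. -/
structure IsSchedule (τ : ℕ → ℕ → ℝ) (a b : ℕ → ℝ) (r : ℕ → ℕ) (k : ℕ) (t s : ℝ)
    (x : ℕ → ℝ) : Prop where
  start_le : t ≤ x 0
  le_end : x k ≤ s
  lower : ∀ i ≤ k, a (r i) ≤ x i
  upper : ∀ i ≤ k, x i ≤ b (r i)
  travel : ∀ i < k, x i + τ (r i) (r (i + 1)) ≤ x (i + 1)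

theorem lower_le_delta (τ : ℕ → ℕ → ℝ) (a : ℕ → ℝ) (r : ℕ → ℕ) (t : ℝ) (i : ℕ) :
    a (r i) ≤ delta τ a r t i := by
  cases i <;> exact le_max_right _ _

theorem IsSchedule.delta_le {τ : ℕ → ℕ → ℝ} {a b : ℕ → ℝ} {r : ℕ → ℕ} {k : ℕ} {t s : ℝ}
    {x : ℕ → ℝ} (h : IsSchedule τ a b r k t s x) : ∀ i ≤ k, delta τ a r t i ≤ x i
  | 0, hi => max_le h.start_le (h.lower 0 hi)
  | i + 1, hi => by
    have ih := h.delta_le i (by omega)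
    have htravel := h.travel i (by omega)
    exact max_le (by linarith) (h.lower (i + 1) hi)

/-- A route is feasible with arrival by `s` exactly when it admits a schedule; the earliest arrival
times form the pointwise smallest one. -/
theorem feasible_and_delta_le_iff_exists_isSchedule {τ : ℕ → ℕ → ℝ} {a b : ℕ → ℝ} {r : ℕ → ℕ}
    {k : ℕ} {t s : ℝ} (ht : a (r 0) ≤ t) :
    (Feasible τ a b r k t ∧ delta τ a r t k ≤ s) ↔ ∃ x, IsSchedule τ a b r k t s x := by
  constructor
  · rintro ⟨⟨-, hb⟩, hs⟩
    exact ⟨delta τ a r t, le_max_left _ _, hs, fun i _ => lower_le_delta τ a r t i, hb,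
      fun i _ => le_max_left _ _⟩
  · rintro ⟨x, hx⟩
    exact ⟨⟨ht, fun i hi => (hx.delta_le i hi).trans (hx.upper i hi)⟩,
      (hx.delta_le k le_rfl).trans hx.le_end⟩

theorem IsSchedule.reverse {τ τ' : ℕ → ℕ → ℝ} {a b a' b' : ℕ → ℝ} {r r' : ℕ → ℕ} {k : ℕ}
    {t s T : ℝ} {x : ℕ → ℝ} (h : IsSchedule τ a b r k t s x)
    (hr : ∀ m ≤ k, r' m = r (k - m)) (hτ : ∀ u v, τ' u v = τ v u)
    (ha : ∀ v, a' v = T - b v) (hb : ∀ v, b' v = T - a v) :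
    IsSchedule τ' a' b' r' k (T - s) (T - t) (fun m => T - x (k - m)) where
  start_le := sub_le_sub_left h.le_end T
  le_end := by
    rw [Nat.sub_self]
    exact sub_le_sub_left h.start_le T
  lower i hi := by
    rw [hr i hi, ha]
    linarith [h.upper (k - i) (Nat.sub_le k i)]
  upper i hi := by
    rw [hr i hi, hb]
    linarith [h.lower (k - i) (Nat.sub_le k i)]
  travel i hi := by
    have htravel := h.travel (k - (i + 1)) (by omega)
    rw [show k - (i + 1) + 1 = k - i by omega] at htravel
    rw [hr i hi.le, hr (i + 1) hi, hτ]
    linarith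

/-- Reversal: with the reverse network (travel times `τ' x y = τ y x`, time windows
`[T − b x, T − a x]`), for `t, s ∈ [0, T]` with `t ≥ a (r 0)` and `s ≤ b (r k)`,
`R` is feasible for `t` with `δ_D(R, t) ≤ s` iff the reversed route `R⁻¹` is
feasible for `T − s` in `D⁻¹` with `δ_{D⁻¹}(R⁻¹, T − s) ≤ T − t`. -/
theorem stmt15 (τ : ℕ → ℕ → ℝ) (a b : ℕ → ℝ) (T : ℝ)
    (hab : ∀ x, a x ≤ b x) (hT : 0 ≤ T) (hwin : ∀ x, 0 ≤ a x ∧ b x ≤ T)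
    (r : ℕ → ℕ) (k : ℕ)
    (rrev : ℕ → ℕ) (hrev : ∀ m ≤ k, rrev m = r (k - m))
    (τ' : ℕ → ℕ → ℝ) (a' b' : ℕ → ℝ)
    (hτ' : ∀ x y, τ' x y = τ y x) (ha' : ∀ x, a' x = T - b x) (hb' : ∀ x, b' x = T - a x)
    (t s : ℝ) (htT : t ∈ Set.Icc (0 : ℝ) T) (hsT : s ∈ Set.Icc (0 : ℝ) T)
    (ht : a (r 0) ≤ t) (hs : s ≤ b (r k)) :
    (Feasible τ a b r k t ∧ delta τ a r t k ≤ s) ↔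
      (Feasible τ' a' b' rrev k (T - s) ∧ delta τ' a' rrev (T - s) k ≤ T - t) := by
  have hrev' : ∀ m ≤ k, r m = rrev (k - m) := fun m hm => by
    rw [hrev (k - m) (Nat.sub_le k m), Nat.sub_sub_self hm]
  have hs' : a' (rrev 0) ≤ T - s := by
    rw [hrev 0 (Nat.zero_le k), Nat.sub_zero, ha']
    linarith
  rw [feasible_and_delta_le_iff_exists_isSchedule ht,
    feasible_and_delta_le_iff_exists_isSchedule hs']
  constructor
  · rintro ⟨x, hx⟩
    exact ⟨_, hx.reverse hrev hτ' ha' hb'⟩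
  · rintro ⟨x, hx⟩
    have hx' := hx.reverse (T := T) (τ' := τ) (a' := a) (b' := b) hrev' (fun u v => (hτ' v u).symm)
      (fun v => by rw [hb', sub_sub_cancel]) (fun v => by rw [ha', sub_sub_cancel])
    rw [sub_sub_cancel, sub_sub_cancel] at hx'
    exact ⟨_, hx'⟩
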